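/- arXiv:2207.14602 — 10 statements merged into one kernel-verified Lean document; each statement's English description precedes it below -/
import Mathlib

section
/- Let Λ be a Γ-semimodule of length s with basis (λ_{-1}, λ_0, …, λ_s), and let k, i be indices with 0 ≤ k < i ≤ s. Then the axis u_{i+1} satisfies u_{i+1} < c_{Λ_k} + n, where c_{Λ_k} is the conductor of the semimodule Λ_k = (λ_{-1}+Γ) ∪ … ∪ (λ_k+Γ). -/
/-- The numerical semigroup `Γ = {a·n + b·m : a, b ∈ ℕ}`. -/
def Gam (n m : ℕ) : Set ℕ := {x | ∃ a b : ℕ, x = a * n + b * m}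

/-- `Λ` is a `Γ`-semimodule: a nonempty subset of `ℕ` with `Λ + Γ ⊆ Λ`. -/
def IsSemimodule (n m : ℕ) (Λ : Set ℕ) : Prop :=
  Λ.Nonempty ∧ ∀ x ∈ Λ, ∀ g ∈ Gam n m, x + g ∈ Λ

/-- The translate `c + Γ`. -/
def GamShift (n m c : ℕ) : Set ℕ := {x | ∃ g ∈ Gam n m, x = c + g}

/-- For a sequence `lam : ℕ → ℕ` (where `lam i` encodes the paper's `λ_{i-1}`),
`LamUnion n m lam j = (lam 0 + Γ) ∪ ⋯ ∪ (lam j + Γ)`; the paper's `Λ_k` is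
`LamUnion n m lam (k+1)`. -/
def LamUnion (n m : ℕ) (lam : ℕ → ℕ) (j : ℕ) : Set ℕ :=
  {x | ∃ i ≤ j, x ∈ GamShift n m (lam i)}

/-- `lam 0, lam 1, …, lam (s+1)` encodes the (strictly increasing) basis
`(λ_{-1}, λ_0, …, λ_s)` of `Λ`: each `λ_j ∉ Λ_{j-1}` for `0 ≤ j ≤ s` and `Λ = Λ_s`. -/
def IsBasisOf (n m : ℕ) (Λ : Set ℕ) (s : ℕ) (lam : ℕ → ℕ) : Prop :=
  (∀ i j, i < j → j ≤ s + 1 → lam i < lam j) ∧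
  (∀ j, 1 ≤ j → j ≤ s + 1 → lam j ∉ LamUnion n m lam (j - 1)) ∧
  Λ = LamUnion n m lam (s + 1)

/-- The axes: `axisU 0 = λ_{-1}` and, in the paper's indexing,
`axisU i = min (Λ_{i-2} ∩ (λ_{i-1} + Γ))` for `1 ≤ i ≤ s+1`. -/
noncomputable def axisU (n m : ℕ) (lam : ℕ → ℕ) : ℕ → ℕ
  | 0 => lam 0
  | i + 1 => sInf (LamUnion n m lam i ∩ GamShift n m (lam (i + 1)))

/-- The conductor of a subset of `ℕ`: the least `c` such that every `x ≥ c` belongs. -/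
noncomputable def conductorOf (Λ : Set ℕ) : ℕ := sInf {c | ∀ x, c ≤ x → x ∈ Λ}

/-- The critical orders (shifted indexing: `critT i` is the paper's `t_{i-1}`):
`t_{-1} = n`, `t_0 = m`, and `t_i = t_{i-1} + u_i - λ_{i-1}` for `i ≥ 1`. -/
noncomputable def critT (n m : ℕ) (lam : ℕ → ℕ) : ℕ → ℕ
  | 0 => n
  | 1 => m
  | i + 2 => critT n m lam (i + 1) + (axisU n m lam (i + 1) - lam (i + 1))

/-- The first limit `ℓ1 = min {p : n·p + λ_s ∈ Λ_{s-1}}`. -/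
noncomputable def limit1 (n m s : ℕ) (lam : ℕ → ℕ) : ℕ :=
  sInf {p | n * p + lam (s + 1) ∈ LamUnion n m lam s}

/-- The second limit `ℓ2 = min {q : m·q + λ_s ∈ Λ_{s-1}}`. -/
noncomputable def limit2 (n m s : ℕ) (lam : ℕ → ℕ) : ℕ :=
  sInf {q | m * q + lam (s + 1) ∈ LamUnion n m lam s}

/-- The top `q1`, determined by `λ_s + n·ℓ1 ∈ I_{q1}` where `I_q = [nq, n(q+1))`. -/
noncomputable def top1 (n m s : ℕ) (lam : ℕ → ℕ) : ℕ := (lam (s + 1) + n * limit1 n m s lam) / n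

/-- The top `q2`, determined by `λ_s + m·ℓ2 ∈ I_{q2}`. -/
noncomputable def top2 (n m s : ℕ) (lam : ℕ → ℕ) : ℕ := (lam (s + 1) + m * limit2 n m s lam) / n

/-- The main top `Q_Λ = max (q1, q2)`. -/
noncomputable def mainTop (n m s : ℕ) (lam : ℕ → ℕ) : ℕ := max (top1 n m s lam) (top2 n m s lam)

/-- The interval `I_q = {nq, nq+1, …, n(q+1)-1}`. -/
def Iq (n q : ℕ) : Set ℕ := {x | n * q ≤ x ∧ x < n * (q + 1)}

/-- The `q`-level set `R_q(S) = ξ(ρ(S ∩ I_q)) ⊆ {0,…,n-1}`, where `ρ : ℤ → ℤ/nℤ` and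
`ξ : ℤ/nℤ → {0,…,n-1}` is determined by `ξ⁻¹(k) = ρ(k·m)`. -/
def Rlevel (n m : ℕ) (S : Set ℕ) (q : ℕ) : Set ℕ :=
  {r | r < n ∧ ∃ x ∈ S, x ∈ Iq n q ∧ r * m ≡ x [MOD n]}

/-- The circular interval `<r,s>` inside `{0,…,n-1}`. -/
def CircInt (n r s : ℕ) : Set ℕ :=
  if r ≤ s then Set.Icc r s else Set.Icc r (n - 1) ∪ Set.Icc 0 s

/-- A subset of `{0,…,n-1}` is a circular interval if it equals some `<r,s>`. -/
def IsCircInt (n : ℕ) (A : Set ℕ) : Prop := ∃ r s, r < n ∧ s < n ∧ A = CircInt n r s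

/-- A coprime pair generates a numerical semigroup that contains all large enough integers. -/
theorem mem_Gam_of_mul_le {n m : ℕ} (hcop : Nat.Coprime n m) {x : ℕ}
    (hx : n * m ≤ x) : x ∈ Gam n m := by
  obtain ⟨a, b, h⟩ := Nat.exists_add_mul_eq_of_gcd_dvd_of_mul_pred_le n m x
    (by rw [hcop]; exact one_dvd x) (le_trans (Nat.mul_le_mul (Nat.pred_le n) (Nat.pred_le m)) hx)
  exact ⟨a, b, h.symm⟩

theorem LamUnion_mono (n m : ℕ) (lam : ℕ → ℕ) : Monotone (LamUnion n m lam) :=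
  fun _ _ hjj' _ ⟨i, hi, hx⟩ => ⟨i, hi.trans hjj', hx⟩

/-- Every integer from the conductor on belongs to a finite union of translates of `Γ`. -/
theorem mem_LamUnion_of_conductorOf_le {n m : ℕ} (hcop : Nat.Coprime n m)
    (lam : ℕ → ℕ) (j : ℕ) {x : ℕ} (hx : conductorOf (LamUnion n m lam j) ≤ x) :
    x ∈ LamUnion n m lam j := by
  have hne : {c | ∀ x, c ≤ x → x ∈ LamUnion n m lam j}.Nonempty :=
    ⟨lam 0 + n * m, fun y hy => ⟨0, j.zero_le, y - lam 0,
      mem_Gam_of_mul_le hcop (by omega), by omega⟩⟩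
  exact Nat.sInf_mem hne x hx

/-- Adding multiples of `n` to some `l < c` reaches the interval `[c, c + n)`. -/
theorem exists_add_mul_mem_Ico {n l c : ℕ} (hn : 0 < n) (hl : l < c) :
    ∃ p, c ≤ l + p * n ∧ l + p * n < c + n := by
  refine ⟨(c - l + (n - 1)) / n, ?_⟩
  have h₁ := Nat.div_add_mod (c - l + (n - 1)) n
  have h₂ := Nat.mod_lt (c - l + (n - 1)) hn
  rw [Nat.mul_comm] at h₁
  omega

/-- For a `Γ`-semimodule `Λ` of length `s` with basis `(λ_{-1}, …, λ_s)` and indices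
`0 ≤ k < i ≤ s`, the axis satisfies `u_{i+1} < c_{Λ_k} + n`.
(Shifted indexing: `lam j` is the paper's `λ_{j-1}`, so the paper's `Λ_k` is
`LamUnion n m lam (k+1)`; `axisU` and the axes are indexed as in the paper.) -/
theorem axis_lt_conductor_add (n m : ℕ) (hn : 2 ≤ n) (hnm : n < m) (hcop : Nat.Coprime n m)
    (Λ : Set ℕ) (s : ℕ) (lam : ℕ → ℕ) (hΛ : IsSemimodule n m Λ)
    (hb : IsBasisOf n m Λ s lam) (k i : ℕ) (hki : k < i) (his : i ≤ s) :
    axisU n m lam (i + 1) < conductorOf (LamUnion n m lam (k + 1)) + n := by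
  have hn0 : 0 < n := by omega
  have hsub := LamUnion_mono n m lam (show k + 1 ≤ i by omega)
  have hl : lam (i + 1) < conductorOf (LamUnion n m lam (k + 1)) := by
    by_contra! h
    exact hb.2.1 (i + 1) (by omega) (by omega)
      (hsub (mem_LamUnion_of_conductorOf_le hcop lam (k + 1) h))
  obtain ⟨p, hp, hp'⟩ := exists_add_mul_mem_Ico hn0 hl
  refine lt_of_le_of_lt (Nat.sInf_le ⟨?_, ?_⟩) hp'
  · exact hsub (mem_LamUnion_of_conductorOf_le hcop lam (k + 1) hp)
  · exact ⟨p * n, ⟨p, 0, by simp⟩, rfl⟩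
end

section
/- Let Λ be a Γ-semimodule with basis (λ_{-1}, λ_0, λ_1, …, λ_s) where λ_{-1} = n and λ_0 = m. Then every axis satisfies u_{i+1} < nm, for all 0 ≤ i ≤ s. -/
theorem exists_mul_lt_modEq {n m : ℕ} (hn : n ≠ 0) (hm : m ≠ 0) (hcop : Nat.Coprime n m) (x : ℕ) :
    ∃ c, c * m < n * m ∧ c * m ≡ x [MOD n] := by
  obtain ⟨h₁, h₂⟩ := (Nat.chineseRemainder hcop x 0).2
  have hlt := Nat.chineseRemainder_lt_mul hcop x 0 hn hm
  obtain ⟨c, hc⟩ := (Nat.modEq_zero_iff_dvd).1 h₂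
  rw [hc, mul_comm] at hlt h₁
  exact ⟨c, by linarith, h₁⟩

/-- From a positive integer outside `(n + Γ) ∪ (m + Γ)`, adding a multiple of `n` reaches a
positive multiple of `m` below `n * m`. -/
theorem exists_mul_lt_eq_add_of_notMem {n m x : ℕ} (hn : n ≠ 0) (hm : m ≠ 0)
    (hcop : Nat.Coprime n m) (hx : x ≠ 0) (hxn : x ∉ GamShift n m n) (hxm : x ∉ GamShift n m m) :
    ∃ c a, (c + 1) * m < n * m ∧ (c + 1) * m = x + a * n := by
  obtain ⟨c, hlt, hmod⟩ := exists_mul_lt_modEq hn hm hcop x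
  rcases le_total (c * m) x with hle | hle
  · exfalso
    obtain ⟨a, ha⟩ := (Nat.modEq_iff_dvd' hle).1 hmod
    have hxe : x = c * m + n * a := by omega
    rcases c with _ | c
    · rcases a with _ | a
      · exact hx (by simpa using hxe)
      · exact hxn ⟨_, ⟨a, 0, rfl⟩, by rw [hxe]; ring⟩
    · exact hxm ⟨_, ⟨a, c, rfl⟩, by rw [hxe]; ring⟩
  · obtain ⟨a, ha⟩ := (Nat.modEq_iff_dvd' hle).1 hmod.symm
    rcases c with _ | c
    · exact absurd (by simpa using hle) hx
    · exact ⟨c, a, hlt, by rw [mul_comm a]; omega⟩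

/-- For a `Γ`-semimodule with basis `(n, m, λ_1, …, λ_s)`, every axis satisfies
`u_{i+1} < nm` for `0 ≤ i ≤ s`. (Shifted indexing: `lam j` is the paper's `λ_{j-1}`.) -/
theorem axis_lt_nm (n m : ℕ) (hn : 2 ≤ n) (hnm : n < m) (hcop : Nat.Coprime n m)
    (Λ : Set ℕ) (s : ℕ) (lam : ℕ → ℕ) (hΛ : IsSemimodule n m Λ)
    (hb : IsBasisOf n m Λ s lam) (h0 : lam 0 = n) (h1 : lam 1 = m)
    (i : ℕ) (his : i ≤ s) :
    axisU n m lam (i + 1) < n * m := by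
  obtain ⟨hmono, hnot, -⟩ := hb
  rcases i with _ | i
  · have hmem : n + m ∈ LamUnion n m lam 0 ∩ GamShift n m (lam 1) := by
      rw [h1]
      exact ⟨⟨0, le_rfl, m, ⟨0, 1, by ring⟩, by rw [h0]⟩, n, ⟨1, 0, by ring⟩, add_comm n m⟩
    exact (Nat.sInf_le hmem).trans_lt (by nlinarith)
  · have hgt := hmono 0 (i + 2) (by omega) (by omega)
    have hni : lam (i + 2) ∉ LamUnion n m lam (i + 1) := hnot (i + 2) (by omega) (by omega)
    obtain ⟨c, a, hlt, hca⟩ := exists_mul_lt_eq_add_of_notMem (by omega) (by omega) hcop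
      (x := lam (i + 2)) (by omega) (fun h => hni ⟨0, by omega, by rwa [h0]⟩)
      (fun h => hni ⟨1, by omega, by rwa [h1]⟩)
    have hmem : (c + 1) * m ∈ LamUnion n m lam (i + 1) ∩ GamShift n m (lam (i + 2)) :=
      ⟨⟨1, by omega, c * m, ⟨0, c, by ring⟩, by rw [h1]; ring⟩, a * n, ⟨a, 0, by ring⟩, hca⟩
    exact (Nat.sInf_le hmem).trans_lt hlt
end

section
/- Let Λ be a Γ-semimodule with basis (λ_{-1}, λ_0, …, λ_s), s ≥ 0. Then there is a unique index k with −1 ≤ k ≤ s−1 such that u_{s+1} ∈ λ_k + Γ, and there are unique pairs (a,b), (c,d) ∈ ℤ≥0 × ℤ≥0 with u_{s+1} = λ_s + na + mb and u_{s+1} = λ_k + nc + md. Moreover these pairs satisfy ac = bd = ab = cd = 0 and (a,b) ≠ (0,0) ≠ (c,d). -/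
theorem mem_gamShift_iff {n m c x : ℕ} :
    x ∈ GamShift n m c ↔ ∃ p : ℕ × ℕ, x = c + n * p.1 + m * p.2 := by
  constructor
  · rintro ⟨_, ⟨a, b, rfl⟩, rfl⟩
    exact ⟨(a, b), by ring⟩
  · rintro ⟨⟨a, b⟩, rfl⟩
    exact ⟨a * n + b * m, ⟨a, b, rfl⟩, by ring⟩

/-- Any two translates of `Γ` meet when `n` and `m` are coprime. -/
theorem gamShift_inter_nonempty {n m : ℕ} (hn : 0 < n) (hcop : Nat.Coprime n m) {c d : ℕ}
    (hcd : c ≤ d) : (GamShift n m c ∩ GamShift n m d).Nonempty := by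
  obtain ⟨k, -, hk⟩ := Nat.exists_mul_mod_eq_of_coprime (n := m) (k := n) (n * d - (d - c))
    hcop.symm hn.ne'
  have hle : d - c ≤ n * d := (Nat.sub_le d c).trans (Nat.le_mul_of_pos_left d hn)
  have hdvd : n ∣ d - c + m * k := by
    have h : d - c + m * k ≡ d - c + (n * d - (d - c)) [MOD n] := Nat.ModEq.add_left _ hk
    rw [Nat.add_sub_cancel' hle] at h
    exact h.symm.dvd_iff dvd_rfl |>.mp (dvd_mul_right n d)
  obtain ⟨a, ha⟩ := hdvd
  refine ⟨d + m * k, mem_gamShift_iff.2 ⟨(a, 0), ?_⟩, mem_gamShift_iff.2 ⟨(0, k), ?_⟩⟩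
  · simp only [mul_zero, add_zero]
    omega
  · simp

theorem axisU_succ_mem {n m : ℕ} (hn : 0 < n) (hcop : Nat.Coprime n m) {lam : ℕ → ℕ} {i : ℕ}
    (hlam : lam 0 ≤ lam (i + 1)) :
    axisU n m lam (i + 1) ∈ LamUnion n m lam i ∩ GamShift n m (lam (i + 1)) := by
  obtain ⟨x, hx0, hx⟩ := gamShift_inter_nonempty hn hcop hlam
  exact Nat.sInf_mem ⟨x, ⟨0, i.zero_le, hx0⟩, hx⟩

theorem axisU_succ_le {n m : ℕ} {lam : ℕ → ℕ} {i k x : ℕ} (hk : k ≤ i) (p q : ℕ × ℕ)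
    (hp : x = lam (i + 1) + n * p.1 + m * p.2) (hq : x = lam k + n * q.1 + m * q.2) :
    axisU n m lam (i + 1) ≤ x :=
  Nat.sInf_le ⟨⟨k, hk, mem_gamShift_iff.2 ⟨q, hq⟩⟩, mem_gamShift_iff.2 ⟨p, hp⟩⟩

/-- The coefficients of `n`, and likewise those of `m`, in expressions of an axis from the new
generator and from an earlier one cannot both be positive. -/
theorem axisU_succ_mul_eq_zero {n m : ℕ} (hn : 0 < n) (hm : 0 < m) {lam : ℕ → ℕ} {i k : ℕ}
    (hk : k ≤ i) {a b c d : ℕ} (hp : axisU n m lam (i + 1) = lam (i + 1) + n * a + m * b)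
    (hq : axisU n m lam (i + 1) = lam k + n * c + m * d) : a * c = 0 ∧ b * d = 0 := by
  constructor
  · by_contra h
    obtain ⟨ha, hc⟩ := Nat.mul_ne_zero_iff.1 h
    obtain ⟨a, rfl⟩ := Nat.exists_eq_succ_of_ne_zero ha
    obtain ⟨c, rfl⟩ := Nat.exists_eq_succ_of_ne_zero hc
    rw [Nat.mul_succ] at hp hq
    have := axisU_succ_le (n := n) (m := m) (lam := lam) hk (a, b) (c, d) rfl (by dsimp only; omega)
    dsimp only at this
    omega
  · by_contra h
    obtain ⟨hb, hd⟩ := Nat.mul_ne_zero_iff.1 h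
    obtain ⟨b, rfl⟩ := Nat.exists_eq_succ_of_ne_zero hb
    obtain ⟨d, rfl⟩ := Nat.exists_eq_succ_of_ne_zero hd
    rw [Nat.mul_succ] at hp hq
    have := axisU_succ_le (n := n) (m := m) (lam := lam) hk (a, b) (c, d) rfl (by dsimp only; omega)
    dsimp only at this
    omega

/-- Generators of a basis are pairwise incongruent modulo `n` and modulo `m`. -/
theorem IsBasisOf.eq_of_add_mul_eq {n m : ℕ} {Λ : Set ℕ} {s : ℕ} {lam : ℕ → ℕ}
    (hb : IsBasisOf n m Λ s lam) {t : ℕ} (ht : t = n ∨ t = m) {i j a b : ℕ} (hi : i ≤ s + 1)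
    (hj : j ≤ s + 1) (h : lam i + t * a = lam j + t * b) : i = j := by
  wlog hij : i < j generalizing i j a b
  · rcases (not_lt.1 hij).lt_or_eq with hji | hji
    · exact (this hj hi h.symm hji).symm
    · exact hji.symm
  have hlt := hb.1 i j hij hj
  have hba : b ≤ a := by
    by_contra! hab
    have := Nat.mul_le_mul_left t hab.le
    omega
  obtain ⟨e, rfl⟩ := Nat.exists_eq_add_of_le hba
  rw [mul_add] at h
  refine absurd ⟨i, by omega, mem_gamShift_iff.2 ?_⟩ (hb.2.1 j (by omega) hj)
  rcases ht with rfl | rfl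
  · exact ⟨(e, 0), by simp only [mul_zero, add_zero]; omega⟩
  · exact ⟨(0, e), by simp only [mul_zero, add_zero]; omega⟩

theorem eq_of_orthogonal_of_add_eq {n m : ℕ} (hn : 0 < n) (hm : 0 < m) {c : ℕ} {p p' q : ℕ × ℕ}
    (h₁ : p.1 * q.1 = 0) (h₂ : p.2 * q.2 = 0) (h₁' : p'.1 * q.1 = 0) (h₂' : p'.2 * q.2 = 0)
    (hq : q ≠ (0, 0)) (h : c + n * p.1 + m * p.2 = c + n * p'.1 + m * p'.2) : p = p' := by
  have hpp : (p.1 = 0 ∧ p'.1 = 0) ∨ (p.2 = 0 ∧ p'.2 = 0) := by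
    simp only [mul_eq_zero, ne_eq, Prod.ext_iff] at h₁ h₂ h₁' h₂' hq
    tauto
  rcases hpp with ⟨h0, h0'⟩ | ⟨h0, h0'⟩ <;> rw [h0, h0'] at h
  · exact Prod.ext (h0.trans h0'.symm) (Nat.eq_of_mul_eq_mul_left hm (by omega))
  · exact Prod.ext (Nat.eq_of_mul_eq_mul_left hn (by omega)) (h0.trans h0'.symm)

/-- For a `Γ`-semimodule with basis `(λ_{-1}, …, λ_s)`, `s ≥ 0`: there is a unique index
`k` with `-1 ≤ k ≤ s-1` (shifted: `k ≤ s`, with `lam k` the paper's `λ_{k-1}`) such that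
`u_{s+1} ∈ λ_k + Γ`; there are unique pairs `(a,b)` and `(c,d)` of nonnegative integers with
`u_{s+1} = λ_s + na + mb` and `u_{s+1} = λ_k + nc + md`; and these pairs satisfy
`ac = bd = ab = cd = 0` and `(a,b) ≠ (0,0) ≠ (c,d)`. -/
theorem axis_unique_expressions (n m : ℕ) (hn : 2 ≤ n) (hnm : n < m) (hcop : Nat.Coprime n m)
    (Λ : Set ℕ) (s : ℕ) (lam : ℕ → ℕ) (hΛ : IsSemimodule n m Λ)
    (hb : IsBasisOf n m Λ s lam) :
    (∃! k : ℕ, k ≤ s ∧ axisU n m lam (s + 1) ∈ GamShift n m (lam k)) ∧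
    (∃! p : ℕ × ℕ, axisU n m lam (s + 1) = lam (s + 1) + n * p.1 + m * p.2) ∧
    (∀ k, k ≤ s → axisU n m lam (s + 1) ∈ GamShift n m (lam k) →
      ∃! p : ℕ × ℕ, axisU n m lam (s + 1) = lam k + n * p.1 + m * p.2) ∧
    (∀ p q : ℕ × ℕ, axisU n m lam (s + 1) = lam (s + 1) + n * p.1 + m * p.2 →
      ∀ k, k ≤ s → axisU n m lam (s + 1) = lam k + n * q.1 + m * q.2 →
      p.1 * q.1 = 0 ∧ p.2 * q.2 = 0 ∧ p.1 * p.2 = 0 ∧ q.1 * q.2 = 0 ∧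
      p ≠ (0, 0) ∧ q ≠ (0, 0)) := by
  have hn0 : 0 < n := by omega
  have hm0 : 0 < m := by omega
  have hmem := axisU_succ_mem hn0 hcop (hb.1 0 (s + 1) s.succ_pos le_rfl).le
  have orth : ∀ p q : ℕ × ℕ, axisU n m lam (s + 1) = lam (s + 1) + n * p.1 + m * p.2 →
      ∀ k, k ≤ s → axisU n m lam (s + 1) = lam k + n * q.1 + m * q.2 →
      p.1 * q.1 = 0 ∧ p.2 * q.2 = 0 ∧ p.1 * p.2 = 0 ∧ q.1 * q.2 = 0 ∧
      p ≠ (0, 0) ∧ q ≠ (0, 0) := by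
    rintro ⟨a, b⟩ ⟨c, d⟩ hp k hk hq
    obtain ⟨hac, hbd⟩ := axisU_succ_mul_eq_zero hn0 hm0 hk hp hq
    have hab : ¬(a = 0 ∧ b = 0) := by
      rintro ⟨rfl, rfl⟩
      refine hb.2.1 (s + 1) (by omega) le_rfl ⟨k, hk, mem_gamShift_iff.2 ⟨(c, d), ?_⟩⟩
      simpa using hp.symm.trans hq
    have hcd : ¬(c = 0 ∧ d = 0) := by
      rintro ⟨rfl, rfl⟩
      have := hb.1 k (s + 1) (by omega) le_rfl
      simp only [mul_zero, add_zero] at hp hq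
      omega
    simp only [mul_eq_zero, ne_eq, Prod.mk.injEq] at hac hbd ⊢
    tauto
  obtain ⟨⟨k, hk, hku⟩, hsu⟩ := hmem
  obtain ⟨p, hp⟩ := mem_gamShift_iff.1 hsu
  obtain ⟨q, hq⟩ := mem_gamShift_iff.1 hku
  refine ⟨⟨k, ⟨hk, hku⟩, ?_⟩, ⟨p, hp, ?_⟩, ?_, orth⟩
  · rintro k' ⟨hk', hku'⟩
    obtain ⟨q', hq'⟩ := mem_gamShift_iff.1 hku'
    obtain ⟨h1, h2, -, -, hp0, -⟩ := orth p q hp k hk hq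
    obtain ⟨h1', h2', -⟩ := orth p q' hp k' hk' hq'
    have hqq : (q.1 = 0 ∧ q'.1 = 0) ∨ (q.2 = 0 ∧ q'.2 = 0) := by
      simp only [mul_eq_zero, ne_eq, Prod.ext_iff] at h1 h2 h1' h2' hp0
      tauto
    rcases hqq with ⟨h, h'⟩ | ⟨h, h'⟩ <;> rw [h] at hq <;> rw [h'] at hq' <;>
      simp only [mul_zero, add_zero] at hq hq'
    · exact hb.eq_of_add_mul_eq (.inr rfl) (by omega) (by omega) (hq'.symm.trans hq)
    · exact hb.eq_of_add_mul_eq (.inl rfl) (by omega) (by omega) (hq'.symm.trans hq)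
  · intro p' hp'
    obtain ⟨h1, h2, -, -, -, hq0⟩ := orth p q hp k hk hq
    obtain ⟨h1', h2', -⟩ := orth p' q hp' k hk hq
    exact eq_of_orthogonal_of_add_eq hn0 hm0 h1' h2' h1 h2 hq0 (hp'.symm.trans hp)
  · intro k' hk' hku'
    obtain ⟨q', hq'⟩ := mem_gamShift_iff.1 hku'
    refine ⟨q', hq', fun r hr => ?_⟩
    obtain ⟨h1, h2, -, -, hp0, -⟩ := orth p q' hp k' hk' hq'
    obtain ⟨h1', h2', -⟩ := orth p r hp k' hk' hr
    rw [mul_comm] at h1 h2 h1' h2'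
    exact eq_of_orthogonal_of_add_eq hn0 hm0 h1' h2' h1 h2 hp0 (hr.symm.trans hq')
end

section
/- Let Λ be a Γ-semimodule with basis (λ_{-1}, λ_0, …, λ_s), s ≥ 0, and let ℓ1, ℓ2 be its limits. If a, b ∈ ℤ≥0 satisfy an + bm + λ_s ∈ Λ_{s-1}, then either a ≥ ℓ1 or b ≥ ℓ2. -/
/-- For a `Γ`-semimodule with basis `(λ_{-1}, …, λ_s)`, `s ≥ 0`, with limits `ℓ1, ℓ2`:
if `na + mb + λ_s ∈ Λ_{s-1}`, then `a ≥ ℓ1` or `b ≥ ℓ2`.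
(Shifted indexing: `lam (s+1)` is the paper's `λ_s` and `LamUnion n m lam s` is `Λ_{s-1}`.) -/
theorem limits_bound (n m : ℕ) (hn : 2 ≤ n) (hnm : n < m) (hcop : Nat.Coprime n m)
    (Λ : Set ℕ) (s : ℕ) (lam : ℕ → ℕ) (hΛ : IsSemimodule n m Λ)
    (hb : IsBasisOf n m Λ s lam) (a b : ℕ)
    (h : n * a + m * b + lam (s + 1) ∈ LamUnion n m lam s) :
    limit1 n m s lam ≤ a ∨ limit2 n m s lam ≤ b := by
  obtain ⟨hmono, hnot, -⟩ := hb
  obtain ⟨i, hi, _, ⟨c, d, rfl⟩, heq⟩ := h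
  have hlt : lam i < lam (s + 1) := hmono i (s + 1) (by omega) le_rfl
  rcases le_total a c with hac | hca
  · obtain ⟨p, rfl⟩ := Nat.exists_eq_add_of_le hac
    rcases le_total b d with hbd | hdb
    · obtain ⟨q, rfl⟩ := Nat.exists_eq_add_of_le hbd
      refine absurd ?_ (hnot (s + 1) (by omega) le_rfl)
      exact ⟨i, hi, _, ⟨p, q, rfl⟩, by linarith⟩
    · obtain ⟨q, rfl⟩ := Nat.exists_eq_add_of_le hdb
      have hmem : m * q + lam (s + 1) ∈ LamUnion n m lam s :=
        ⟨i, hi, _, ⟨p, 0, rfl⟩, by linarith⟩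
      exact Or.inr (Nat.le_add_left_of_le (Nat.sInf_le hmem))
  · obtain ⟨p, rfl⟩ := Nat.exists_eq_add_of_le hca
    rcases le_total b d with hbd | hdb
    · obtain ⟨q, rfl⟩ := Nat.exists_eq_add_of_le hbd
      have hmem : n * p + lam (s + 1) ∈ LamUnion n m lam s :=
        ⟨i, hi, _, ⟨0, q, rfl⟩, by linarith⟩
      exact Or.inl (Nat.le_add_left_of_le (Nat.sInf_le hmem))
    · obtain ⟨q, rfl⟩ := Nat.exists_eq_add_of_le hdb
      have hnp : 0 ≤ n * p := Nat.zero_le _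
      have hmq : 0 ≤ m * q := Nat.zero_le _
      exact absurd hlt (by linarith)
end

section
/- Let Λ be a Γ-semimodule with basis (n, m, λ_1, …, λ_s) and let 1 ≤ i ≤ s. If λ_ℓ > u_ℓ for every 0 ≤ ℓ ≤ i, then λ_j − λ_k > t_j − t_k for all indices −1 ≤ k < j ≤ i with j ≥ 1. -/
/-- For a `Γ`-semimodule with basis `(n, m, λ_1, …, λ_s)` and `1 ≤ i ≤ s`: if `λ_ℓ > u_ℓ`
for every `0 ≤ ℓ ≤ i`, then `λ_j - λ_k > t_j - t_k` for all `-1 ≤ k < j ≤ i` with `j ≥ 1`.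
(Shifted indexing: `lam j'` and `critT j'` are the paper's `λ_{j'-1}` and `t_{j'-1}`.) -/
theorem lambda_diff_gt_t_diff (n m : ℕ) (hn : 2 ≤ n) (hnm : n < m) (hcop : Nat.Coprime n m)
    (Λ : Set ℕ) (s : ℕ) (lam : ℕ → ℕ) (hΛ : IsSemimodule n m Λ)
    (hb : IsBasisOf n m Λ s lam) (h0 : lam 0 = n) (h1 : lam 1 = m)
    (i : ℕ) (hi1 : 1 ≤ i) (his : i ≤ s)
    (hinc : ∀ l, l ≤ i → axisU n m lam l < lam (l + 1)) :
    ∀ k j : ℕ, k < j → 2 ≤ j → j ≤ i + 1 →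
      (critT n m lam j : ℤ) - critT n m lam k < (lam j : ℤ) - lam k := by
  have step (l : ℕ) (hl : 1 ≤ l) (hli : l ≤ i) :
      (critT n m lam (l + 1) : ℤ) - critT n m lam l < (lam (l + 1) : ℤ) - lam l := by
    obtain ⟨l, rfl⟩ := Nat.exists_eq_add_of_le' hl
    have hu := hinc (l + 1) hli
    have hmono := hb.1 (l + 1) (l + 1 + 1) (by omega) (by omega)
    have ht : critT n m lam (l + 1 + 1) =
        critT n m lam (l + 1) + (axisU n m lam (l + 1) - lam (l + 1)) := rfl
    rw [ht]
    omega
  have ht0 : critT n m lam 0 = n := rfl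
  have ht1 : critT n m lam 1 = m := rfl
  intro k j hkj hj
  induction j, hj using Nat.le_induction with
  | base =>
    intro hji
    have hs := step 1 le_rfl (by omega)
    interval_cases k <;> simp only [Nat.reduceAdd] at hs <;> omega
  | succ j hj ih =>
    intro hji
    have hs := step j (by omega) (by omega)
    rcases Nat.lt_succ_iff_lt_or_eq.mp hkj with hlt | rfl
    · have := ih hlt (by omega)
      omega
    · exact hs
end

section
/- Let Λ be an increasing Γ-semimodule with basis (n, m, λ_1, …, λ_s). Then the critical orders satisfy t_i < nm for every −1 ≤ i ≤ s+1. -/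
theorem exists_add_mul_modEq_zero {n m : ℕ} (hn : 2 ≤ n) (hcop : Nat.Coprime n m) (x : ℕ) :
    ∃ b < n, n ∣ x + b * m := by
  obtain ⟨k, hk⟩ := Nat.exists_mul_mod_eq_one_of_coprime hcop.symm (by omega)
  refine ⟨((n - 1) * x * k) % n, Nat.mod_lt _ (by omega), ?_⟩
  have hmk : m * k ≡ 1 [MOD n] := hk.2.trans (Nat.mod_eq_of_lt (by omega)).symm
  have h : x + (((n - 1) * x * k) % n) * m ≡ x + (n - 1) * x * 1 [MOD n] := by
    refine Nat.ModEq.add_left _ (((Nat.mod_modEq _ n).mul_right m).trans ?_)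
    have := hmk.mul_left ((n - 1) * x)
    convert this using 1
    ring
  refine (Nat.modEq_zero_iff_dvd).1 (h.trans ((Nat.modEq_zero_iff_dvd).2 ⟨x, ?_⟩))
  obtain ⟨d, rfl⟩ : ∃ d, n = d + 1 := ⟨n - 1, by omega⟩
  simp only [Nat.add_sub_cancel]
  ring

/-- A positive gap of `Γ` meets the multiples of `n` below `n * m` after adding multiples of `m`. -/
theorem exists_add_mul_eq_mul_of_notMem_Gam {n m x : ℕ} (hn : 2 ≤ n) (hcop : Nat.Coprime n m)
    (hx : x ∉ Gam n m) : ∃ b c, 1 ≤ c ∧ c < m ∧ x + b * m = c * n := by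
  obtain ⟨b, hb, c, hc⟩ := exists_add_mul_modEq_zero hn hcop x
  refine ⟨b, c, ?_, ?_, by rw [hc, mul_comm]⟩
  · rcases Nat.eq_zero_or_pos c with rfl | h
    · exact absurd ⟨0, 0, by simp at hc; omega⟩ hx
    · exact h
  · by_contra! hcm
    obtain ⟨d, rfl⟩ := Nat.exists_eq_add_of_le hcm
    obtain ⟨e, rfl⟩ := Nat.exists_eq_add_of_lt hb
    refine hx ⟨d, e + 1, ?_⟩
    nlinarith

theorem mem_GamShift_of_mem_Gam {n m x : ℕ} (hx : x ∈ Gam n m) (h0 : x ≠ 0) :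
    x ∈ GamShift n m n ∨ x ∈ GamShift n m m := by
  obtain ⟨a, b, rfl⟩ := hx
  rcases a with _ | a
  · rcases b with _ | b
    · simp at h0
    · exact .inr ⟨_, ⟨0, b, rfl⟩, by ring⟩
  · exact .inl ⟨_, ⟨a, b, rfl⟩, by ring⟩

theorem axisU_succ_mem_s6 {n m : ℕ} {lam : ℕ → ℕ} {i x : ℕ}
    (hx : x ∈ LamUnion n m lam i ∩ GamShift n m (lam (i + 1))) :
    lam (i + 1) ≤ axisU n m lam (i + 1) ∧ axisU n m lam (i + 1) ≤ x := by
  refine ⟨?_, Nat.sInf_le hx⟩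
  obtain ⟨-, g, -, hg⟩ := Nat.sInf_mem ⟨x, hx⟩
  exact (Nat.le_add_right _ g).trans hg.ge

theorem axisU_succ_bounds {n m : ℕ} (hn : 2 ≤ n) (hnm : n < m) (hcop : Nat.Coprime n m)
    {lam : ℕ → ℕ} (h0 : lam 0 = n) (h1 : lam 1 = m) {i : ℕ}
    (hpos : 0 < lam (i + 1)) (hgap : lam (i + 1) ∉ LamUnion n m lam i) :
    lam (i + 1) ≤ axisU n m lam (i + 1) ∧ axisU n m lam (i + 1) < n * m := by
  suffices h : ∃ x ∈ LamUnion n m lam i ∩ GamShift n m (lam (i + 1)), x < n * m by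
    obtain ⟨x, hx, hlt⟩ := h
    exact ⟨(axisU_succ_mem_s6 hx).1, (axisU_succ_mem_s6 hx).2.trans_lt hlt⟩
  rcases i with _ | i
  · refine ⟨n + m, ⟨⟨0, le_rfl, m, ⟨0, 1, by ring⟩, by rw [h0]⟩,
      ⟨n, ⟨1, 0, by ring⟩, by rw [h1, add_comm]⟩⟩, by nlinarith⟩
  · have hΓ : lam (i + 1 + 1) ∉ Gam n m := fun h => by
      rcases mem_GamShift_of_mem_Gam h hpos.ne' with h | h
      · exact hgap ⟨0, by omega, by rwa [h0]⟩
      · exact hgap ⟨1, by omega, by rwa [h1]⟩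
    obtain ⟨b, c, hc, hcm, h⟩ := exists_add_mul_eq_mul_of_notMem_Gam hn hcop hΓ
    obtain ⟨d, rfl⟩ := Nat.exists_eq_add_of_le hc
    refine ⟨(1 + d) * n, ⟨⟨0, by omega, d * n, ⟨d, 0, by ring⟩, by rw [h0]; ring⟩,
      ⟨b * m, ⟨0, b, by ring⟩, h.symm⟩⟩, ?_⟩
    rw [mul_comm n m]
    exact Nat.mul_lt_mul_of_pos_right hcm (by omega)

/-- For an increasing `Γ`-semimodule with basis `(n, m, λ_1, …, λ_s)`, the critical orders
satisfy `t_i < nm` for every `-1 ≤ i ≤ s+1`.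
(Shifted indexing: `critT i'` is the paper's `t_{i'-1}`; increasing means `λ_i > u_i`
for `0 ≤ i ≤ s`, i.e. `axisU i < lam (i+1)`.) -/
theorem critT_lt_nm (n m : ℕ) (hn : 2 ≤ n) (hnm : n < m) (hcop : Nat.Coprime n m)
    (Λ : Set ℕ) (s : ℕ) (lam : ℕ → ℕ) (hΛ : IsSemimodule n m Λ)
    (hb : IsBasisOf n m Λ s lam) (h0 : lam 0 = n) (h1 : lam 1 = m)
    (hinc : ∀ i, i ≤ s → axisU n m lam i < lam (i + 1)) :
    ∀ i, i ≤ s + 2 → critT n m lam i < n * m := by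
  have hu : ∀ i ≤ s, lam (i + 1) ≤ axisU n m lam (i + 1) ∧ axisU n m lam (i + 1) < n * m :=
    fun i hi => axisU_succ_bounds hn hnm hcop h0 h1
      ((Nat.zero_le _).trans_lt (hb.1 0 (i + 1) (by omega) (by omega)))
      (hb.2.1 (i + 1) (by omega) (by omega))
  have ht : ∀ i ≤ s, critT n m lam (i + 2) ≤ axisU n m lam (i + 1) := by
    intro i
    induction i with
    | zero =>
      intro hi
      have := (hu 0 hi).1
      simp only [critT, zero_add] at this ⊢
      omega
    | succ k ih =>
      intro hk
      have hstep : critT n m lam (k + 1 + 2) =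
        critT n m lam (k + 2) + (axisU n m lam (k + 2) - lam (k + 2)) := rfl
      have h1 := ih (by omega)
      have h2 : axisU n m lam (k + 1) < lam (k + 2) := hinc (k + 1) hk
      have h3 : lam (k + 2) ≤ axisU n m lam (k + 2) := (hu (k + 1) hk).1
      rw [hstep]
      change _ ≤ axisU n m lam (k + 2)
      omega
  intro i hi
  match i with
  | 0 =>
    change n < n * m
    nlinarith
  | 1 =>
    change m < n * m
    nlinarith
  | i + 2 => exact (ht i (by omega)).trans_lt (hu i (by omega)).2
end

section
/- Let 1 ≤ n < m be coprime integers with co-pair (b,d). Set (n1, m1) = (n, m−n) if m ≥ 2n and (n1, m1) = (m−n, n) if m < 2n. Then the co-pair (b1, d1) of (n1, m1) is given by (b1, d1) = (b, d−b) if m ≥ 2n and by (b1, d1) = (m−n−d+b, n−b) if m < 2n. Moreover Ψ(R^{n,m}) = R^{n1,m1}, where Ψ is the linear automorphism of ℝ² given by Ψ(α,β) = (α+β, β) if m ≥ 2n and Ψ(α,β) = (β, α+β) if m < 2n. -/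
/-- `(b,d)` is the co-pair of `(n,m)`: `dn - bm = 1` with `0 ≤ b < n` and `0 < d ≤ m`. -/
def IsCoPair (n m : ℕ) (b d : ℤ) : Prop :=
  d * n - b * m = 1 ∧ 0 ≤ b ∧ b < n ∧ 0 < d ∧ d ≤ m

/-- The region `R^{n,m} ⊆ ℝ²` determined by the co-pair `(b,d)` of `(n,m)`:
`(n-b)α + (m-d)β ≥ 0` and `bα + dβ ≥ 0`. -/
def Region (n m : ℕ) (b d : ℤ) : Set (ℝ × ℝ) :=
  {p | 0 ≤ ((n : ℝ) - (b : ℝ)) * p.1 + ((m : ℝ) - (d : ℝ)) * p.2 ∧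
       0 ≤ (b : ℝ) * p.1 + (d : ℝ) * p.2}

/-- The second entry of a co-pair exceeds the first. -/
theorem IsCoPair.fst_lt_snd {n m : ℕ} {b d : ℤ} (hnm : n ≤ m) (h : IsCoPair n m b d) :
    b < d := by
  obtain ⟨h1, h2, h3, -, -⟩ := h
  have hnm' : (n : ℤ) ≤ m := by exact_mod_cast hnm
  by_contra! hdb
  nlinarith [mul_le_mul_of_nonneg_left hnm' h2]

/-- The complementary pair `(n - b, m - d)` of a co-pair is weakly increasing. -/
theorem IsCoPair.sub_le_sub {n m : ℕ} {b d : ℤ} (hnm : n < m) (h : IsCoPair n m b d) :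
    n - b ≤ m - d := by
  obtain ⟨h1, h2, h3, -, -⟩ := h
  have hnm' : (n : ℤ) + 1 ≤ m := by exact_mod_cast hnm
  have hb : (0 : ℤ) ≤ n - b := by linarith
  by_contra! hlt
  have hle : (m : ℤ) - d ≤ n - b - 1 := by linarith
  nlinarith [mul_le_mul_of_nonneg_left hnm' hb,
    mul_le_mul_of_nonneg_left hle (Int.natCast_nonneg n)]


/-- For coprime `1 ≤ n < m` with co-pair `(b,d)` and `(n1,m1) = (n, m-n)` if `m ≥ 2n`,
`(n1,m1) = (m-n, n)` if `m < 2n`: the co-pair of `(n1,m1)` is `(b, d-b)`, resp.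
`(m-n-d+b, n-b)`, and `Ψ(R^{n,m}) = R^{n1,m1}` where `Ψ(α,β) = (α+β,β)`, resp.
`Ψ(α,β) = (β,α+β)`. -/
theorem copair_region_transform (n m : ℕ) (b d : ℤ) (hn : 1 ≤ n) (hnm : n < m)
    (hcop : Nat.Coprime n m) (h : IsCoPair n m b d) :
    (2 * n ≤ m →
      IsCoPair n (m - n) b (d - b) ∧
      (fun p : ℝ × ℝ => (p.1 + p.2, p.2)) '' Region n m b d = Region n (m - n) b (d - b)) ∧
    (m < 2 * n →
      IsCoPair (m - n) n ((m : ℤ) - n - d + b) ((n : ℤ) - b) ∧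
      (fun p : ℝ × ℝ => (p.2, p.1 + p.2)) '' Region n m b d
        = Region (m - n) n ((m : ℤ) - n - d + b) ((n : ℤ) - b)) := by
  have hbd := h.fst_lt_snd hnm.le
  have hsub := h.sub_le_sub hnm
  obtain ⟨h1, h2, h3, h4, h5⟩ := h
  have hle := hnm.le
  refine ⟨fun _ => ⟨?_, ?_⟩, fun _ => ⟨?_, ?_⟩⟩
  · refine ⟨?_, h2, h3, by linarith, ?_⟩
    · push_cast [hle]
      linear_combination h1
    · push_cast [hle]
      linarith
  · ext ⟨x, y⟩
    simp only [Region, Set.mem_image, Set.mem_ofPred_eq, Prod.mk.injEq]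
    push_cast [hle]
    constructor
    · rintro ⟨⟨u, v⟩, ⟨hu, hv⟩, rfl, rfl⟩
      constructor <;> linarith
    · rintro ⟨hx, hy⟩
      refine ⟨(x - y, y), ⟨?_, ?_⟩, by ring, rfl⟩ <;> linarith
  · refine ⟨?_, by linarith, ?_, by linarith, by linarith⟩
    · push_cast [hle]
      linear_combination h1
    · push_cast [hle]
      linarith
  · ext ⟨x, y⟩
    simp only [Region, Set.mem_image, Set.mem_ofPred_eq, Prod.mk.injEq]
    push_cast [hle]
    constructor
    · rintro ⟨⟨u, v⟩, ⟨hu, hv⟩, rfl, rfl⟩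
      constructor <;> linarith
    · rintro ⟨hx, hy⟩
      refine ⟨(y - x, x), ⟨?_, ?_⟩, rfl, by ring⟩ <;> linarith
end

section
/- For any μ ∈ ℤ≥0 and any q ≥ 1, the cardinality of the q-level set of μ + Γ satisfies #R_q(μ+Γ) ≤ #R_{q-1}(μ+Γ) + 1. -/
/-- An element of the `(q+1)`-level set of `μ + Γ` that is not in the `q`-level set comes from
an element `μ + b·m` of `I_{q+1}`. -/
lemma Rlevel_gamShift_new {n m μ q r : ℕ} (hr : r ∈ Rlevel n m (GamShift n m μ) (q + 1))
    (hr' : r ∉ Rlevel n m (GamShift n m μ) q) :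
    r < n ∧ ∃ b, μ + b * m ∈ Iq n (q + 1) ∧ r * m ≡ μ + b * m [MOD n] := by
  obtain ⟨hrn, x, ⟨g, ⟨a, b, rfl⟩, rfl⟩, hxI, hx⟩ := hr
  refine ⟨hrn, ?_⟩
  cases a with
  | zero => exact ⟨b, by simpa using hxI, by simpa using hx⟩
  | succ a =>
    have hadd : μ + ((a + 1) * n + b * m) = μ + (a * n + b * m) + n := by ring
    rw [hadd] at hxI hx
    refine absurd ⟨hrn, _, ⟨_, ⟨a, b, rfl⟩, rfl⟩, ?_, ?_⟩ hr'
    · simp only [Iq, Set.mem_ofPred_eq, mul_add, mul_one] at hxI ⊢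
      omega
    · simpa [Nat.ModEq] using hx

/-- The interval `I_q` contains at most one term of an arithmetic progression whose common
difference exceeds `n`. -/
lemma Iq_progression_unique {n m μ q b c : ℕ} (hnm : n < m)
    (hb : μ + b * m ∈ Iq n q) (hc : μ + c * m ∈ Iq n q) : b = c := by
  simp only [Iq, Set.mem_ofPred_eq, mul_add, mul_one] at hb hc
  rcases lt_trichotomy b c with h | h | h
  · nlinarith [Nat.mul_le_mul_right m (Nat.succ_le_of_lt h)]
  · exact h
  · nlinarith [Nat.mul_le_mul_right m (Nat.succ_le_of_lt h)]

/-- For any `μ ∈ ℕ` and `q ≥ 1`, the cardinality of the `q`-level set of `μ + Γ` satisfies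
`#R_q(μ+Γ) ≤ #R_{q-1}(μ+Γ) + 1`. -/
theorem level_card_step (n m : ℕ) (hn : 2 ≤ n) (hnm : n < m) (hcop : Nat.Coprime n m)
    (μ q : ℕ) (hq : 1 ≤ q) :
    (Rlevel n m (GamShift n m μ) q).ncard ≤ (Rlevel n m (GamShift n m μ) (q - 1)).ncard + 1 := by
  obtain ⟨q, rfl⟩ := Nat.exists_eq_add_of_le' hq
  rw [Nat.add_sub_cancel]
  have hfin : ∀ k, (Rlevel n m (GamShift n m μ) k).Finite := fun k =>
    (Set.finite_Iio n).subset fun r hr => hr.1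
  have hsub : (Rlevel n m (GamShift n m μ) (q + 1) \
      Rlevel n m (GamShift n m μ) q).Subsingleton := by
    rintro r ⟨hr, hr'⟩ s ⟨hs, hs'⟩
    obtain ⟨hrn, b, hb, hrb⟩ := Rlevel_gamShift_new hr hr'
    obtain ⟨hsn, c, hc, hsc⟩ := Rlevel_gamShift_new hs hs'
    obtain rfl := Iq_progression_unique hnm hb hc
    exact (Nat.ModEq.cancel_right_of_coprime hcop (hrb.trans hsc.symm)).eq_of_lt_of_lt hrn hsn
  have h₁ := Set.ncard_le_ncard_sdiff_add_ncard (Rlevel n m (GamShift n m μ) (q + 1))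
    (Rlevel n m (GamShift n m μ) q) (hfin q)
  have h₂ := (Set.ncard_le_one (hfin (q + 1)).sdiff).2 fun r hr s hs => hsub hr hs
  omega
end

section
/- Let Λ be a normalized Γ-semimodule with basis (0, λ_0, λ_1, …, λ_s), s ≥ 0. Let v be such that λ_s ∈ I_v and assume that R_q(Λ_{s-1}) is a circular interval for every q ≥ v. Let r = ξ(ρ(λ_s)) and let q1, q2 be the tops of Λ. Then: (1) {0, 1, …, r−1} ⊆ R_q(Λ_{s-1}) for all q ≥ q1 − 1; (2) {r, r+1, …, n−1} ⊆ R_q(Λ) for all q ≥ q2 − 1. In particular, the conductor satisfies c_Λ ≤ n(Q_Λ − 1), where Q_Λ = max(q1, q2) is the main top. -/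
theorem mem_Iq_iff {n q x : ℕ} (hn : 0 < n) : x ∈ Iq n q ↔ x / n = q := by
  rw [Nat.div_eq_iff hn, Iq, Set.mem_ofPred_eq, mul_add, mul_comm n q]
  omega

theorem mem_Gam_of_modEq {n m k x : ℕ} (h : k * m ≡ x [MOD n]) (hx : k * m ≤ x) :
    x ∈ Gam n m := by
  obtain ⟨c, hc⟩ := (Nat.modEq_iff_dvd' hx).1 h
  exact ⟨c, k, by rw [mul_comm c n]; omega⟩

theorem LamUnion_add_mem {n m j x g : ℕ} {lam : ℕ → ℕ} (hx : x ∈ LamUnion n m lam j)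
    (hg : g ∈ Gam n m) : x + g ∈ LamUnion n m lam j := by
  obtain ⟨i, hi, _, ⟨a, b, rfl⟩, rfl⟩ := hx
  obtain ⟨c, d, rfl⟩ := hg
  exact ⟨i, hi, _, ⟨a + c, b + d, rfl⟩, by ring⟩

theorem Gam_subset_LamUnion {n m j : ℕ} {lam : ℕ → ℕ} (h0 : lam 0 = 0) :
    Gam n m ⊆ LamUnion n m lam j :=
  fun x hx => ⟨0, Nat.zero_le _, x, hx, by rw [h0, zero_add]⟩

theorem LamUnion_mono_s10 {n m j k : ℕ} {lam : ℕ → ℕ} (h : j ≤ k) :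
    LamUnion n m lam j ⊆ LamUnion n m lam k :=
  fun _ ⟨i, hi, hx⟩ => ⟨i, hi.trans h, hx⟩

theorem mem_Rlevel_of_mem {n m j k x q : ℕ} {lam : ℕ → ℕ} (hk : k < n)
    (hx : x ∈ LamUnion n m lam j) (hkx : k * m ≡ x [MOD n]) (hq : x / n ≤ q) :
    k ∈ Rlevel n m (LamUnion n m lam j) q := by
  have hn : 0 < n := by omega
  refine ⟨hk, x + (q - x / n) * n, LamUnion_add_mem hx ⟨q - x / n, 0, by simp⟩, ?_, ?_⟩
  · rw [mem_Iq_iff hn, Nat.add_mul_div_right _ _ hn]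
    omega
  · exact hkx.trans (by simp [Nat.ModEq])

theorem zero_mem_Rlevel {n m j q : ℕ} {lam : ℕ → ℕ} (hn : 0 < n) (h0 : lam 0 = 0) :
    0 ∈ Rlevel n m (LamUnion n m lam j) q :=
  mem_Rlevel_of_mem (x := 0) hn (Gam_subset_LamUnion h0 ⟨0, 0, by simp⟩) (by simp [Nat.ModEq])
    (by simp)

theorem Rlevel_LamUnion_mono {n m j p q : ℕ} {lam : ℕ → ℕ} (h : p ≤ q) :
    Rlevel n m (LamUnion n m lam j) p ⊆ Rlevel n m (LamUnion n m lam j) q := by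
  rintro k ⟨hk, x, hx, hxp, hkx⟩
  exact mem_Rlevel_of_mem hk hx hkx (((mem_Iq_iff (by omega)).1 hxp).trans_le h)

theorem mem_of_mem_Rlevel {n m k x q : ℕ} {S : Set ℕ} (h : k ∈ Rlevel n m S q)
    (hkx : k * m ≡ x [MOD n]) (hq : x / n = q) : x ∈ S := by
  obtain ⟨hk, y, hy, hyq, hky⟩ := h
  have hyx : y % n = x % n := hky.symm.trans hkx
  rw [mem_Iq_iff (by omega)] at hyq
  have := Nat.div_add_mod x n
  have := Nat.div_add_mod y n
  rw [hyq, hyx, ← hq] at this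
  rwa [show x = y by omega]

theorem IsCircInt.mem_of_le {n k x : ℕ} {A : Set ℕ} (hA : IsCircInt n A) (h0 : 0 ∈ A)
    (hk : k ∈ A) (hk1 : k + 1 ∉ A) (hkn : k + 1 < n) (hx : x ≤ k) : x ∈ A := by
  obtain ⟨c, d, hc, hd, rfl⟩ := hA
  unfold CircInt at *
  split_ifs at * <;> simp only [Set.mem_union, Set.mem_Icc] at * <;> omega

theorem IsCircInt.mem_of_ge {n k x : ℕ} {A : Set ℕ} (hA : IsCircInt n A) (h0 : 0 ∈ A)
    (hk : k ∉ A) (hk1 : k + 1 ∈ A) (hx : k + 1 ≤ x) (hxn : x < n) : x ∈ A := by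
  obtain ⟨c, d, hc, hd, rfl⟩ := hA
  unfold CircInt at *
  split_ifs at * <;> simp only [Set.mem_union, Set.mem_Icc] at * <;> omega

theorem exists_lt_mul_modEq {n m : ℕ} (hn : 0 < n) (hcop : Nat.Coprime n m) (x : ℕ) :
    ∃ k < n, k * m ≡ x [MOD n] := by
  obtain ⟨z, hzn, hzm⟩ := Nat.chineseRemainder hcop x 0
  obtain ⟨k, rfl⟩ := (Nat.modEq_zero_iff_dvd).1 hzm
  refine ⟨k % n, Nat.mod_lt _ hn, Nat.ModEq.trans ?_ hzn⟩
  rw [mul_comm m k]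
  exact (Nat.mod_modEq k n).mul_right m

theorem limit1_spec {n m s r : ℕ} {lam : ℕ → ℕ} (hn : 0 < n) (h0 : lam 0 = 0)
    (hrl : r * m ≡ lam (s + 1) [MOD n]) :
    n * limit1 n m s lam + lam (s + 1) ∈ LamUnion n m lam s := by
  refine Nat.sInf_mem (s := {p | n * p + lam (s + 1) ∈ LamUnion n m lam s}) ⟨r * m, ?_⟩
  refine Gam_subset_LamUnion h0 (mem_Gam_of_modEq (k := r) (hrl.trans ?_) ?_)
  · simp [Nat.ModEq]
  · have := Nat.le_mul_of_pos_left (r * m) hn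
    omega

theorem limit2_witness {n m s r : ℕ} {lam : ℕ → ℕ} (h0 : lam 0 = 0) (hr : r < n)
    (hrl : r * m ≡ lam (s + 1) [MOD n]) :
    m * (n - r) + lam (s + 1) ∈ LamUnion n m lam s := by
  refine Gam_subset_LamUnion h0 (mem_Gam_of_modEq (k := 0) ?_ (by simp))
  have h : m * (n - r) + lam (s + 1) ≡ m * (n - r) + r * m [MOD n] := hrl.symm.add_left _
  rw [mul_comm r m, ← mul_add, Nat.sub_add_cancel hr.le] at h
  simpa using (h.trans (Nat.modEq_zero_iff_dvd.2 (dvd_mul_left n m))).symm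

section

variable {n m s v r : ℕ} {lam : ℕ → ℕ}

theorem mem_Rlevel_of_top1_le (hnm : n < m) (hlt : ∀ i ≤ s, lam i < lam (s + 1))
    (hnot : lam (s + 1) ∉ LamUnion n m lam s) (h0 : lam 0 = 0)
    (hv : lam (s + 1) / n = v)
    (hcirc : ∀ q, v ≤ q → IsCircInt n (Rlevel n m (LamUnion n m lam s) q))
    (hr : r < n) (hr0 : 0 < r) (hrl : r * m ≡ lam (s + 1) [MOD n])
    {q : ℕ} (hq : top1 n m s lam - 1 ≤ q) {x : ℕ} (hx : x < r) :
    x ∈ Rlevel n m (LamUnion n m lam s) q := by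
  have hn : 0 < n := by omega
  have hmem := limit1_spec hn h0 hrl
  have hmin : ∀ p < limit1 n m s lam, n * p + lam (s + 1) ∉ LamUnion n m lam s :=
    fun p hp => Nat.notMem_of_lt_sInf (s := {p | n * p + lam (s + 1) ∈ LamUnion n m lam s}) hp
  have htop : top1 n m s lam = v + limit1 n m s lam := by
    rw [top1, Nat.add_mul_div_left _ _ hn, hv]
  generalize limit1 n m s lam = l at *
  obtain _ | l := l
  · simp [hnot] at hmem
  have hbelow := hmin l (by omega)
  rw [htop] at hq
  have hmod : ∀ p, r * m ≡ n * p + lam (s + 1) [MOD n] := fun p => hrl.trans (by simp [Nat.ModEq])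
  have hdiv : ∀ p, (n * p + lam (s + 1)) / n = v + p := fun p => by
    rw [add_comm, Nat.add_mul_div_left _ _ hn, hv]
  obtain ⟨i, hi, _, ⟨a, b, rfl⟩, heq⟩ := hmem
  obtain rfl : a = 0 := by
    rcases a with _ | a
    · rfl
    · exact absurd ⟨i, hi, _, ⟨a, b, rfl⟩, by linarith [mul_comm a n]⟩ hbelow
  rcases b with _ | b
  · have := hlt i hi
    simp at heq
    omega
  obtain ⟨k, rfl⟩ : ∃ k, r = k + 1 := ⟨r - 1, by omega⟩
  have hz : n * (l + 1) + lam (s + 1) = lam i + b * m + m := by linarith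
  refine Rlevel_LamUnion_mono (p := v + l) (by omega)
    ((hcirc (v + l) (by omega)).mem_of_le (k := k) ?_ ?_ ?_ hr (by omega))
  · exact zero_mem_Rlevel hn h0
  · refine mem_Rlevel_of_mem (by omega) (x := lam i + b * m)
      ⟨i, hi, _, ⟨0, b, rfl⟩, by simp⟩ (Nat.ModEq.add_right_cancel' m ?_) ?_
    · rw [← hz]
      simpa [add_mul] using hmod (l + 1)
    · rw [← hdiv l]
      exact Nat.div_le_div_right (by linarith)
  · exact fun h => hbelow (mem_of_mem_Rlevel h (hmod l) (hdiv l))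

theorem mem_Rlevel_of_top2_le (hnm : n < m) (hlt : ∀ i ≤ s, lam i < lam (s + 1))
    (hnot : lam (s + 1) ∉ LamUnion n m lam s) (h0 : lam 0 = 0)
    (hv : lam (s + 1) / n = v)
    (hcirc : ∀ q, v ≤ q → IsCircInt n (Rlevel n m (LamUnion n m lam s) q))
    (hr : r < n) (hrl : r * m ≡ lam (s + 1) [MOD n])
    {q : ℕ} (hq : top2 n m s lam - 1 ≤ q) {x : ℕ} (hrx : r ≤ x) (hx : x < n) :
    x ∈ Rlevel n m (LamUnion n m lam (s + 1)) q := by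
  have hn : 0 < n := by omega
  have hwit := limit2_witness h0 hr hrl
  have hle : limit2 n m s lam ≤ n - r := Nat.sInf_le hwit
  have hmem : m * limit2 n m s lam + lam (s + 1) ∈ LamUnion n m lam s :=
    Nat.sInf_mem (s := {q | m * q + lam (s + 1) ∈ LamUnion n m lam s}) ⟨_, hwit⟩
  have hmin : ∀ p < limit2 n m s lam, m * p + lam (s + 1) ∉ LamUnion n m lam s :=
    fun p hp => Nat.notMem_of_lt_sInf (s := {p | m * p + lam (s + 1) ∈ LamUnion n m lam s}) hp
  have htop : top2 n m s lam = (lam (s + 1) + m * limit2 n m s lam) / n := rfl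
  generalize limit2 n m s lam = l at *
  obtain _ | l := l
  · simp [hnot] at hmem
  have hbelow := hmin l (by omega)
  have hlevel : (m * l + lam (s + 1)) / n ≤ q := by
    have : (m * l + lam (s + 1)) / n + 1 ≤ top2 n m s lam := by
      rw [htop, ← Nat.add_div_right _ hn]
      exact Nat.div_le_div_right (by linarith)
    omega
  have hvw : v ≤ (m * l + lam (s + 1)) / n := hv ▸ Nat.div_le_div_right (by omega)
  have hmod : ∀ p, (r + p) * m ≡ m * p + lam (s + 1) [MOD n] := fun p => by
    rw [add_mul, add_comm, mul_comm p m]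
    exact hrl.add_left _
  rcases Nat.lt_or_ge (r + l) x with hlx | hxl
  · have hsub : Rlevel n m (LamUnion n m lam s) ((m * l + lam (s + 1)) / n) ⊆
        Rlevel n m (LamUnion n m lam (s + 1)) q := fun k hk =>
      have ⟨hkn, y, hy, hyq, hky⟩ := Rlevel_LamUnion_mono hlevel hk
      ⟨hkn, y, LamUnion_mono_s10 (by omega) hy, hyq, hky⟩
    obtain ⟨i, hi, _, ⟨a, b, rfl⟩, heq⟩ := hmem
    obtain rfl : b = 0 := by
      rcases b with _ | b
      · rfl
      · exact absurd ⟨i, hi, _, ⟨a, b, rfl⟩, by linarith⟩ hbelow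
    refine hsub ((hcirc _ hvw).mem_of_ge (k := r + l) ?_ ?_ ?_ hlx hx)
    · exact zero_mem_Rlevel hn h0
    · exact fun h => hbelow (mem_of_mem_Rlevel h (hmod l) rfl)
    · refine mem_Rlevel_of_mem (by omega) (x := lam i) ⟨i, hi, 0, ⟨0, 0, by simp⟩, by simp⟩
        ((hmod (l + 1)).trans ?_) ?_
      · rw [heq]
        simp [Nat.ModEq]
      · exact (Nat.div_le_div_right (hlt i hi).le).trans (hv.trans_le hvw)
  · obtain ⟨p, rfl⟩ := Nat.exists_eq_add_of_le hrx
    refine mem_Rlevel_of_mem hx (x := m * p + lam (s + 1))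
      ⟨s + 1, le_rfl, _, ⟨0, p, rfl⟩, by ring⟩ (hmod p) ?_
    refine (Nat.div_le_div_right ?_).trans hlevel
    have := Nat.mul_le_mul_left m (show p ≤ l by omega)
    omega

theorem one_le_top1 (hn : 0 < n) (hnot : lam (s + 1) ∉ LamUnion n m lam s)
    (h0 : lam 0 = 0) (hrl : r * m ≡ lam (s + 1) [MOD n]) : 1 ≤ top1 n m s lam := by
  have hmem := limit1_spec hn h0 hrl
  rw [top1, Nat.add_mul_div_left _ _ hn]
  rcases Nat.eq_zero_or_pos (limit1 n m s lam) with h | h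
  · simp [h, hnot] at hmem
  · exact le_add_left h

end

/-- Let `Λ` be a normalized `Γ`-semimodule with basis `(0, λ_0, …, λ_s)`, let `λ_s ∈ I_v`
and assume `R_q(Λ_{s-1})` is a circular interval for every `q ≥ v`. With `r = ξ(ρ(λ_s))`
and tops `q1, q2`: (1) `[0, r-1] ⊆ R_q(Λ_{s-1})` for all `q ≥ q1 - 1`;
(2) `[r, n-1] ⊆ R_q(Λ)` for all `q ≥ q2 - 1`. In particular `c_Λ ≤ n(Q_Λ - 1)`.
(Shifted indexing: `lam (s+1)` is `λ_s`, `LamUnion n m lam s` is `Λ_{s-1}`.) -/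
theorem levels_and_conductor_bound (n m : ℕ) (hn : 2 ≤ n) (hnm : n < m)
    (hcop : Nat.Coprime n m) (Λ : Set ℕ) (s : ℕ) (lam : ℕ → ℕ)
    (hΛ : IsSemimodule n m Λ) (hb : IsBasisOf n m Λ s lam) (h0 : lam 0 = 0)
    (v : ℕ) (hv : lam (s + 1) ∈ Iq n v)
    (hcirc : ∀ q, v ≤ q → IsCircInt n (Rlevel n m (LamUnion n m lam s) q))
    (r : ℕ) (hr : r < n) (hrl : r * m ≡ lam (s + 1) [MOD n]) :
    (∀ q, top1 n m s lam - 1 ≤ q → ∀ x, x < r → x ∈ Rlevel n m (LamUnion n m lam s) q) ∧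
    (∀ q, top2 n m s lam - 1 ≤ q → ∀ x, r ≤ x → x ≤ n - 1 → x ∈ Rlevel n m Λ q) ∧
    (conductorOf Λ : ℤ) ≤ n * ((mainTop n m s lam : ℤ) - 1) := by
  obtain ⟨hmono, hnew, rfl⟩ := hb
  have hn0 : 0 < n := by omega
  have hlt : ∀ i ≤ s, lam i < lam (s + 1) := fun i hi => hmono i (s + 1) (by omega) le_rfl
  have hnot : lam (s + 1) ∉ LamUnion n m lam s := hnew (s + 1) (by omega) le_rfl
  have hv' : lam (s + 1) / n = v := (mem_Iq_iff hn0).1 hv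
  have hr0 : 0 < r := by
    rcases Nat.eq_zero_or_pos r with rfl | h
    · exact absurd (Gam_subset_LamUnion h0 (mem_Gam_of_modEq hrl (by simp))) hnot
    · exact h
  have hone : ∀ q, top1 n m s lam - 1 ≤ q → ∀ x, x < r →
      x ∈ Rlevel n m (LamUnion n m lam s) q := fun q hq x hx =>
    mem_Rlevel_of_top1_le hnm hlt hnot h0 hv' hcirc hr hr0 hrl hq hx
  have htwo : ∀ q, top2 n m s lam - 1 ≤ q → ∀ x, r ≤ x → x ≤ n - 1 →
      x ∈ Rlevel n m (LamUnion n m lam (s + 1)) q := fun q hq x hrx hx =>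
    mem_Rlevel_of_top2_le hnm hlt hnot h0 hv' hcirc hr hrl hq hrx (by omega)
  refine ⟨hone, htwo, ?_⟩
  have hQ : 1 ≤ mainTop n m s lam := (one_le_top1 hn0 hnot h0 hrl).trans (le_max_left _ _)
  have hQ1 : top1 n m s lam ≤ mainTop n m s lam := le_max_left _ _
  have hQ2 : top2 n m s lam ≤ mainTop n m s lam := le_max_right _ _
  have hc : conductorOf (LamUnion n m lam (s + 1)) ≤ n * (mainTop n m s lam - 1) := by
    refine Nat.sInf_le fun y hy => ?_
    have hyq : mainTop n m s lam - 1 ≤ y / n := by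
      rwa [Nat.le_div_iff_mul_le hn0, mul_comm]
    obtain ⟨k, hk, hky⟩ := exists_lt_mul_modEq hn0 hcop y
    rcases Nat.lt_or_ge k r with hkr | hkr
    · exact LamUnion_mono_s10 (Nat.le_succ s)
        (mem_of_mem_Rlevel (hone (y / n) (by omega) k hkr) hky rfl)
    · exact mem_of_mem_Rlevel (htwo (y / n) (by omega) k hkr (by omega)) hky rfl
  have hc' : (conductorOf (LamUnion n m lam (s + 1)) : ℤ) ≤ _ := Nat.cast_le.2 hc
  rwa [Nat.cast_mul, Nat.cast_sub hQ, Nat.cast_one] at hc'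
end

section
/- Let Λ be an increasing Γ-semimodule of length s ≥ 0 whose minimal element λ_{-1} is a multiple of n. Then the conductor satisfies c_Λ ≤ n(Q_Λ − 1), where Q_Λ is the main top of Λ. -/
theorem mem_LamUnion {n m : ℕ} {lam : ℕ → ℕ} {j x : ℕ} :
    x ∈ LamUnion n m lam j ↔ ∃ i ≤ j, ∃ a b : ℕ, x = lam i + (a * n + b * m) := by
  constructor
  · rintro ⟨i, hi, _, ⟨a, b, rfl⟩, rfl⟩
    exact ⟨i, hi, a, b, rfl⟩
  · rintro ⟨i, hi, a, b, rfl⟩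
    exact ⟨i, hi, _, ⟨a, b, rfl⟩, rfl⟩

theorem mem_GamShift {n m c x : ℕ} :
    x ∈ GamShift n m c ↔ ∃ a b : ℕ, x = c + (a * n + b * m) := by
  constructor
  · rintro ⟨_, ⟨a, b, rfl⟩, rfl⟩
    exact ⟨a, b, rfl⟩
  · rintro ⟨a, b, rfl⟩
    exact ⟨_, ⟨a, b, rfl⟩, rfl⟩

theorem add_mul_mem_LamUnion {n m : ℕ} {lam : ℕ → ℕ} {j x : ℕ}
    (hx : x ∈ LamUnion n m lam j) (p q : ℕ) : x + (p * n + q * m) ∈ LamUnion n m lam j := by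
  obtain ⟨i, hi, a, b, rfl⟩ := mem_LamUnion.1 hx
  exact mem_LamUnion.2 ⟨i, hi, a + p, b + q, by ring⟩

theorem LamUnion_succ (n m : ℕ) (lam : ℕ → ℕ) (j : ℕ) :
    LamUnion n m lam (j + 1) = LamUnion n m lam j ∪ GamShift n m (lam (j + 1)) := by
  ext x
  constructor
  · rintro ⟨i, hi, hx⟩
    rcases Nat.lt_or_ge i (j + 1) with h | h
    · exact Or.inl ⟨i, by omega, hx⟩
    · obtain rfl : i = j + 1 := by omega
      exact Or.inr hx
  · rintro (⟨i, hi, hx⟩ | hx)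
    · exact ⟨i, by omega, hx⟩
    · exact ⟨j + 1, le_rfl, hx⟩

/-- The residues modulo `n` of the elements of `S` below the threshold `N`. -/
def residuesBelow (n : ℕ) (S : Set ℕ) (N : ℕ) : Set (ZMod n) :=
  {c | ∃ y ∈ S, (y : ZMod n) = c ∧ y < N}

theorem residuesBelow_union (n : ℕ) (S T : Set ℕ) (N : ℕ) :
    residuesBelow n (S ∪ T) N = residuesBelow n S N ∪ residuesBelow n T N := by
  ext c
  constructor
  · rintro ⟨y, hy | hy, h⟩
    · exact Or.inl ⟨y, hy, h⟩
    · exact Or.inr ⟨y, hy, h⟩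
  · rintro (⟨y, hy, h⟩ | ⟨y, hy, h⟩)
    · exact ⟨y, Or.inl hy, h⟩
    · exact ⟨y, Or.inr hy, h⟩

theorem residuesBelow_mono {n : ℕ} {S T : Set ℕ} (hST : S ⊆ T) {N M : ℕ} (h : N ≤ M) :
    residuesBelow n S N ⊆ residuesBelow n T M := by
  rintro c ⟨y, hy, hc, hN⟩
  exact ⟨y, hST hy, hc, by omega⟩

/-- A subset of `ℤ/n` is an arc of step `m` if it consists of consecutive terms of an arithmetic
progression of difference `m`. -/
def IsArc (n m : ℕ) (A : Set (ZMod n)) : Prop :=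
  ∃ (a : ZMod n) (k : ℕ), A = {c | ∃ i < k, c = a + i * m}

theorem arc_union_arc {n m : ℕ} {a b : ZMod n} {k l i j : ℕ} (hi : i < k)
    (hij : j ≤ i) (h : a + i * m = b + j * m) :
    IsArc n m ({c | ∃ t < k, c = a + t * m} ∪ {c | ∃ t < l, c = b + t * m}) := by
  obtain ⟨d, rfl⟩ := Nat.exists_eq_add_of_le hij
  have hb : b = a + d * m := by
    push_cast at h
    linear_combination -h
  refine ⟨a, max k (d + l), ?_⟩
  ext c
  constructor
  · rintro (⟨t, ht, rfl⟩ | ⟨t, ht, rfl⟩)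
    · exact ⟨t, by omega, rfl⟩
    · exact ⟨d + t, by omega, by rw [hb]; push_cast; ring⟩
  · rintro ⟨t, ht, rfl⟩
    by_cases htk : t < k
    · exact Or.inl ⟨t, htk, rfl⟩
    · obtain ⟨e, rfl⟩ := Nat.exists_eq_add_of_le (show d ≤ t by omega)
      exact Or.inr ⟨e, by omega, by rw [hb]; push_cast; ring⟩

theorem IsArc.union {n m : ℕ} {A B : Set (ZMod n)} (hA : IsArc n m A) (hB : IsArc n m B)
    (h : (A ∩ B).Nonempty) : IsArc n m (A ∪ B) := by
  obtain ⟨a, k, rfl⟩ := hA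
  obtain ⟨b, l, rfl⟩ := hB
  obtain ⟨c, ⟨i, hi, hci⟩, ⟨j, hj, hcj⟩⟩ := h
  rcases le_total j i with hij | hij
  · exact arc_union_arc hi hij (hci.symm.trans hcj)
  · rw [Set.union_comm]
    exact arc_union_arc hj hij (hcj.symm.trans hci)

theorem isArc_GamShift {n m : ℕ} (hm : 0 < m) (c N : ℕ) :
    IsArc n m (residuesBelow n (GamShift n m c) N) := by
  have hex : ∃ k, N ≤ c + k * m := ⟨N, by nlinarith⟩
  refine ⟨c, Nat.find hex, ?_⟩
  ext z
  constructor
  · rintro ⟨y, hy, rfl, hyN⟩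
    obtain ⟨a, b, rfl⟩ := mem_GamShift.1 hy
    refine ⟨b, ?_, by push_cast; simp⟩
    by_contra hb
    have h1 := Nat.find_spec hex
    have h2 : Nat.find hex * m ≤ b * m := Nat.mul_le_mul_right _ (by omega)
    omega
  · rintro ⟨i, hi, rfl⟩
    have h := Nat.find_min hex hi
    exact ⟨c + (0 * n + i * m), mem_GamShift.2 ⟨0, i, rfl⟩, by push_cast; ring, by omega⟩

theorem exists_eq_add_mul {n m : ℕ} (hn : 0 < n) (hcop : Nat.Coprime n m) (a c : ZMod n) :
    ∃ z < n, c = a + z * m := by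
  have : NeZero n := ⟨hn.ne'⟩
  refine ⟨((c - a) * (m : ZMod n)⁻¹).val, ZMod.val_lt _, ?_⟩
  rw [ZMod.natCast_zmod_val, mul_assoc, mul_comm _ (m : ZMod n),
    ZMod.coe_mul_inv_eq_one m hcop.symm]
  ring

theorem exists_eq_add_mul_of_cast_eq {n x y : ℕ} (hxy : x ≤ y)
    (h : (x : ZMod n) = (y : ZMod n)) : ∃ k, y = x + k * n := by
  obtain ⟨k, hk⟩ := (Nat.modEq_iff_dvd' hxy).1 ((ZMod.natCast_eq_natCast_iff x y n).1 h)
  exact ⟨k, by rw [mul_comm k n]; omega⟩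

theorem LamUnion_inter_nonempty {n m : ℕ} (hn : 0 < n) (hcop : Nat.Coprime n m)
    (lam : ℕ → ℕ) (j c : ℕ) : (LamUnion n m lam j ∩ GamShift n m c).Nonempty := by
  obtain ⟨z, -, hz⟩ := exists_eq_add_mul hn hcop (lam 0 : ZMod n) (c : ZMod n)
  have hcast : ((lam 0 + z * m : ℕ) : ZMod n) = ((c + (lam 0 + z * m) * n : ℕ) : ZMod n) := by
    push_cast
    simp [hz]
  obtain ⟨k, hk⟩ := exists_eq_add_mul_of_cast_eq (le_add_of_le_right (Nat.le_mul_of_pos_right _ hn)) hcast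
  exact ⟨c + (lam 0 + z * m) * n, mem_LamUnion.2 ⟨0, by omega, k, z, by rw [hk]; ring⟩,
    mem_GamShift.2 ⟨lam 0 + z * m, 0, by ring⟩⟩

theorem exists_mul_left_add_mem_LamUnion {n m : ℕ} (hn : 0 < n) (hcop : Nat.Coprime n m)
    (lam : ℕ → ℕ) (j c : ℕ) : ∃ p, n * p + c ∈ LamUnion n m lam j := by
  obtain ⟨z, -, hz⟩ := exists_eq_add_mul hn hcop (lam 0 : ZMod n) (c : ZMod n)
  have hcast : ((lam 0 + z * m : ℕ) : ZMod n) = ((n * (lam 0 + z * m) + c : ℕ) : ZMod n) := by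
    push_cast
    simp [hz]
  obtain ⟨k, hk⟩ := exists_eq_add_mul_of_cast_eq (le_add_of_le_left (Nat.le_mul_of_pos_left _ hn)) hcast
  exact ⟨lam 0 + z * m, mem_LamUnion.2 ⟨0, by omega, k, z, by rw [hk]; ring⟩⟩

theorem LamUnion_swap (n m : ℕ) (lam : ℕ → ℕ) (j : ℕ) :
    LamUnion n m lam j = LamUnion m n lam j := by
  ext x
  simp only [mem_LamUnion]
  constructor <;>
  · rintro ⟨i, hi, a, b, h⟩
    exact ⟨i, hi, b, a, by rw [h]; ring⟩

theorem isArc_LamUnion {n m : ℕ} (hn : 0 < n) (hm : 0 < m) (hcop : Nat.Coprime n m)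
    {lam : ℕ → ℕ} {s : ℕ} (hinc : ∀ i, i < s → axisU n m lam i < lam (i + 1)) :
    ∀ j ≤ s, ∀ N, axisU n m lam j < N → IsArc n m (residuesBelow n (LamUnion n m lam j) N) := by
  intro j
  induction j with
  | zero =>
    intro _ N _
    have h : LamUnion n m lam 0 = GamShift n m (lam 0) := by
      ext x
      simp [LamUnion]
    rw [h]
    exact isArc_GamShift hm _ _
  | succ j ih =>
    intro hj N hN
    obtain ⟨hu1, hu2⟩ : axisU n m lam (j + 1) ∈ LamUnion n m lam j ∩ GamShift n m (lam (j + 1)) :=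
      Nat.sInf_mem (LamUnion_inter_nonempty hn hcop lam j _)
    have hle : lam (j + 1) ≤ axisU n m lam (j + 1) := by
      obtain ⟨a, b, h⟩ := mem_GamShift.1 hu2
      omega
    have hlt := hinc j (by omega)
    rw [LamUnion_succ, residuesBelow_union]
    exact (ih (by omega) N (by omega)).union (isArc_GamShift hm _ _)
      ⟨_, ⟨_, hu1, rfl, hN⟩, ⟨_, hu2, rfl, hN⟩⟩

/-- If all generators of `Λ_j` lie below `N₀` and the residues below `N₀` form an arc starting
at `a`, then every residue occurring below a larger threshold `N` is reached from `a` by steps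
of size `m` through residues occurring below `N`. -/
theorem exists_path_of_mem_residuesBelow {n m : ℕ} {lam : ℕ → ℕ} {j N₀ N : ℕ} (hN : N₀ ≤ N)
    (hlam : ∀ i ≤ j, lam i < N₀) {a : ZMod n} {k : ℕ}
    (hA : residuesBelow n (LamUnion n m lam j) N₀ = {c | ∃ i < k, c = a + i * m})
    {c : ZMod n} (hc : c ∈ residuesBelow n (LamUnion n m lam j) N) :
    ∃ t : ℕ, c = a + t * m ∧
      ∀ t' ≤ t, a + t' * m ∈ residuesBelow n (LamUnion n m lam j) N := by
  obtain ⟨y, hy, rfl, hyN⟩ := hc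
  obtain ⟨i, hi, p, b, rfl⟩ := mem_LamUnion.1 hy
  have hmem : (lam i : ZMod n) ∈ residuesBelow n (LamUnion n m lam j) N₀ :=
    ⟨lam i, mem_LamUnion.2 ⟨i, hi, 0, 0, by simp⟩, rfl, hlam i hi⟩
  rw [hA] at hmem
  obtain ⟨d, hd, hde⟩ := hmem
  refine ⟨d + b, by push_cast; rw [hde]; simp; ring, fun t ht => ?_⟩
  by_cases htk : t < k
  · apply residuesBelow_mono subset_rfl hN
    rw [hA]
    exact ⟨t, htk, rfl⟩
  · obtain ⟨e, rfl⟩ := Nat.exists_eq_add_of_le (show d ≤ t by omega)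
    have he : e * m ≤ b * m := Nat.mul_le_mul_right _ (by omega)
    exact ⟨lam i + (0 * n + e * m), mem_LamUnion.2 ⟨i, hi, 0, e, rfl⟩,
      by push_cast; rw [hde]; ring, by omega⟩

/-- If every residue occurs in `Λ_j` below `N`, then every `x ≥ N - n` lies in `Λ_j`. -/
theorem mem_LamUnion_of_residuesBelow {n m : ℕ} {lam : ℕ → ℕ} {j N : ℕ}
    (h : ∀ c, c ∈ residuesBelow n (LamUnion n m lam j) N) {x : ℕ} (hx : N ≤ x + n) :
    x ∈ LamUnion n m lam j := by
  obtain ⟨y, hy, hc, hyN⟩ := h (x : ZMod n)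
  have hyx : y ≤ x := by
    by_contra hlt
    obtain ⟨k, hk⟩ := exists_eq_add_mul_of_cast_eq (by omega) hc.symm
    rcases k with _ | k
    · omega
    · nlinarith
  obtain ⟨k, rfl⟩ := exists_eq_add_mul_of_cast_eq hyx hc
  simpa using add_mul_mem_LamUnion hy k 0

theorem residuesBelow_LamUnion_eq_univ {n m : ℕ} (hn : 0 < n) (hnm : n < m)
    (hcop : Nat.Coprime n m) {lam : ℕ → ℕ} {s N : ℕ}
    (hmono : ∀ i ≤ s, lam i < lam (s + 1)) (hnot : lam (s + 1) ∉ LamUnion n m lam s)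
    (hinc : ∀ i, i ≤ s → axisU n m lam i < lam (i + 1))
    (h1 : lam (s + 1) + n * limit1 n m s lam < N + n)
    (h2 : lam (s + 1) + m * limit2 n m s lam < N + n) (c : ZMod n) :
    c ∈ residuesBelow n (LamUnion n m lam (s + 1)) N := by
  have hm : 0 < m := by omega
  have hl1 : n * limit1 n m s lam + lam (s + 1) ∈ LamUnion n m lam s :=
    Nat.sInf_mem (exists_mul_left_add_mem_LamUnion hn hcop lam s _)
  have hl2 : m * limit2 n m s lam + lam (s + 1) ∈ LamUnion n m lam s := by
    refine Nat.sInf_mem (s := {q | m * q + lam (s + 1) ∈ LamUnion n m lam s}) ?_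
    obtain ⟨q, hq⟩ := exists_mul_left_add_mem_LamUnion hm hcop.symm lam s (lam (s + 1))
    exact ⟨q, by rwa [Set.mem_ofPred_eq, LamUnion_swap]⟩
  have hmin : ∀ q, m * q + lam (s + 1) ∈ LamUnion n m lam s → limit2 n m s lam ≤ q :=
    fun q hq => Nat.sInf_le hq
  generalize limit1 n m s lam = p at *
  generalize limit2 n m s lam = q at *
  have hnotlt : ∀ y ∈ LamUnion n m lam s, (y : ZMod n) = lam (s + 1) → ¬ y ≤ lam (s + 1) := by
    intro y hy hc hle
    obtain ⟨k, hk⟩ := exists_eq_add_mul_of_cast_eq hle hc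
    apply hnot
    rw [hk]
    simpa using add_mul_mem_LamUnion hy k 0
  have hgen : ∀ i ≤ s, lam i ∈ LamUnion n m lam s := fun i hi =>
    mem_LamUnion.2 ⟨i, hi, 0, 0, by simp⟩
  have hp : p ≠ 0 := by
    rintro rfl
    exact hnot (by simpa using hl1)
  have hq : q ≠ 0 := by
    rintro rfl
    exact hnot (by simpa using hl2)
  have hnp : n ≤ n * p := Nat.le_mul_of_pos_right _ (by omega)
  obtain ⟨a, k, hA⟩ := isArc_LamUnion hn hm hcop (s := s) (fun i hi => hinc i hi.le) s le_rfl
    (lam (s + 1) + 1) (by have := hinc s le_rfl; omega)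
  have hpred : ((lam (s + 1) : ZMod n) - m) ∈ residuesBelow n (LamUnion n m lam s) N := by
    obtain ⟨i, hi, x, b, hb⟩ := mem_LamUnion.1 hl1
    have hcast : (lam (s + 1) : ZMod n) = lam i + b * m := by
      have := congrArg (Nat.cast : ℕ → ZMod n) hb
      push_cast at this
      simpa using this
    rcases b with _ | b
    · exact absurd (hmono i hi).le (hnotlt _ (hgen i hi) (by simp [hcast]))
    · refine ⟨lam i + (0 * n + b * m), mem_LamUnion.2 ⟨i, hi, 0, b, rfl⟩, ?_, ?_⟩
      · rw [hcast]
        push_cast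
        ring
      · have : (b + 1) * m = b * m + m := by ring
        omega
  have hsucc : ((lam (s + 1) : ZMod n) + q * m) ∈
      residuesBelow n (LamUnion n m lam s) (lam (s + 1) + 1) := by
    obtain ⟨i, hi, x, b, hb⟩ := mem_LamUnion.1 hl2
    rcases b with _ | b
    · refine ⟨lam i, hgen i hi, ?_, by have := hmono i hi; omega⟩
      have := congrArg (Nat.cast : ℕ → ZMod n) hb
      push_cast at this
      simp only [CharP.cast_eq_zero, mul_zero, zero_mul, add_zero] at this
      rw [← this]
      ring
    · obtain ⟨q, rfl⟩ := Nat.exists_eq_succ_of_ne_zero hq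
      have : q + 1 ≤ q := hmin q (mem_LamUnion.2 ⟨i, hi, x, b, by
        have e1 : m * (q + 1) = m * q + m := by ring
        have e2 : (b + 1) * m = b * m + m := by ring
        simp only [Nat.succ_eq_add_one] at hb
        omega⟩)
      omega
  obtain ⟨t, ht, hpath⟩ := exists_path_of_mem_residuesBelow
    (show lam (s + 1) + 1 ≤ N by omega) (fun i hi => (hmono i hi).trans (Nat.lt_succ_self _)) hA hpred
  have hr : (lam (s + 1) : ZMod n) = a + (t + 1 : ℕ) * m := by
    push_cast
    linear_combination ht
  have hsub : LamUnion n m lam s ⊆ LamUnion n m lam (s + 1) := by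
    rw [LamUnion_succ]
    exact Set.subset_union_left
  have hcover : ∀ z < t + 1 + q, a + (z : ZMod n) * m ∈
      residuesBelow n (LamUnion n m lam (s + 1)) N := by
    intro z hz
    by_cases hzt : z ≤ t
    · exact residuesBelow_mono hsub le_rfl (hpath z hzt)
    · obtain ⟨e, rfl⟩ := Nat.exists_eq_add_of_le (show t + 1 ≤ z by omega)
      refine ⟨lam (s + 1) + (0 * n + e * m), mem_LamUnion.2 ⟨s + 1, le_rfl, 0, e, rfl⟩, ?_, ?_⟩
      · push_cast
        rw [hr]
        push_cast
        ring
      · have h3 : (e + 1) * m ≤ q * m := Nat.mul_le_mul_right _ (by omega)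
        have h4 : (e + 1) * m = e * m + m := by ring
        rw [mul_comm m q] at h2
        omega
  rw [hA] at hsucc
  obtain ⟨j, hj, hje⟩ := hsucc
  have hlt : j < t + 1 + q := by
    by_contra hge
    have hmem : (lam (s + 1) : ZMod n) ∈
        residuesBelow n (LamUnion n m lam s) (lam (s + 1) + 1) := by
      rw [hA]
      exact ⟨t + 1, by omega, hr⟩
    obtain ⟨y, hy, hyc, hylt⟩ := hmem
    exact hnotlt y hy hyc (by omega)
  have hfull : n ≤ t + 1 + q := by
    have hcast : ((m * j : ℕ) : ZMod n) = ((m * (t + 1 + q) : ℕ) : ZMod n) := by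
      rw [hr] at hje
      push_cast at hje ⊢
      linear_combination -hje
    have hmod := Nat.ModEq.cancel_left_of_coprime hcop ((ZMod.natCast_eq_natCast_iff _ _ n).1 hcast)
    have := Nat.le_of_dvd (by omega) ((Nat.modEq_iff_dvd' hlt.le).1 hmod)
    omega
  obtain ⟨z, hz, rfl⟩ := exists_eq_add_mul hn hcop a c
  exact hcover z (by omega)

/-- Let `Λ` be an increasing `Γ`-semimodule of length `s ≥ 0` whose minimal element
`λ_{-1}` is a multiple of `n`. Then the conductor satisfies `c_Λ ≤ n(Q_Λ - 1)` where
`Q_Λ` is the main top of `Λ`. -/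
theorem conductor_le_mainTop (n m : ℕ) (hn : 2 ≤ n) (hnm : n < m) (hcop : Nat.Coprime n m)
    (Λ : Set ℕ) (s : ℕ) (lam : ℕ → ℕ) (hΛ : IsSemimodule n m Λ)
    (hb : IsBasisOf n m Λ s lam) (hmult : ∃ k, lam 0 = k * n)
    (hinc : ∀ i, i ≤ s → axisU n m lam i < lam (i + 1)) :
    (conductorOf Λ : ℤ) ≤ n * ((mainTop n m s lam : ℤ) - 1) := by
  obtain ⟨hmono, hnot, rfl⟩ := hb
  have hlt : ∀ x Q, x / n ≤ Q → x < n * Q + n := fun x Q h => by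
    have := (Nat.div_lt_iff_lt_mul (by omega : 0 < n)).1 (Nat.lt_succ_of_le h)
    rwa [Nat.succ_mul, mul_comm] at this
  have hfull := residuesBelow_LamUnion_eq_univ (by omega) hnm hcop
    (fun i hi => hmono i (s + 1) (by omega) le_rfl) (hnot (s + 1) (by omega) le_rfl) hinc
    (hlt _ (mainTop n m s lam) (le_max_left _ _)) (hlt _ (mainTop n m s lam) (le_max_right _ _))
  generalize mainTop n m s lam = Q at hfull ⊢
  rcases Q with _ | Q
  · obtain ⟨y, -, -, hy⟩ := hfull 0
    omega
  · have hle : conductorOf (LamUnion n m lam (s + 1)) ≤ n * Q :=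
      Nat.sInf_le fun x hx => mem_LamUnion_of_residuesBelow hfull (by rw [mul_add_one]; omega)
    push_cast
    rw [add_sub_cancel_right]
    exact_mod_cast hle
end
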